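/- Let K be an algebraically closed field of characteristic p > 2. The algebra A_s(m|n) of supersymmetric polynomials is generated over its subalgebra A_s(p) by the elements c_r(x|y) for r ≥ 0. -/

import Mathlib

open MvPolynomial

noncomputable section

/-- The substitution `x_m = y_n = T`, landing in polynomials in `T` over the original ring
(the image only involves the remaining variables). -/
def psiSub (K : Type*) [CommSemiring K] (m n : ℕ) :
    MvPolynomial (Fin m ⊕ Fin n) K →ₐ[K] Polynomial (MvPolynomial (Fin m ⊕ Fin n) K) :=
  MvPolynomial.aeval (Sum.elim
    (fun i : Fin m => if (i : ℕ) = m - 1 then Polynomial.X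
      else Polynomial.C (MvPolynomial.X (Sum.inl i)))
    (fun j : Fin n => if (j : ℕ) = n - 1 then Polynomial.X
      else Polynomial.C (MvPolynomial.X (Sum.inr j))))

/-- `f` is supersymmetric: symmetric in the `x` and `y` variables separately, and
`(d/dT) f|_{x_m = y_n = T} = 0`. -/
def IsSupersymmetric (K : Type*) [CommSemiring K] (m n : ℕ)
    (f : MvPolynomial (Fin m ⊕ Fin n) K) : Prop :=
  (∀ σ : Equiv.Perm (Fin m), MvPolynomial.rename (Sum.map σ id) f = f) ∧
  (∀ τ : Equiv.Perm (Fin n), MvPolynomial.rename (Sum.map id τ) f = f) ∧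
  Polynomial.derivative (psiSub K m n f) = 0

/-- `c_r(x|y) = Σ_{i=0}^{min(r,m)} (−1)^{r−i} σ_i(x) h_{r−i}(y)`. -/
def cpoly (K : Type*) [CommRing K] (m n r : ℕ) : MvPolynomial (Fin m ⊕ Fin n) K :=
  ∑ i ∈ Finset.range (min r m + 1),
    (-1 : MvPolynomial (Fin m ⊕ Fin n) K) ^ (r - i) *
      (MvPolynomial.rename Sum.inl (MvPolynomial.esymm (Fin m) K i)) *
      (MvPolynomial.rename Sum.inr (MvPolynomial.hsymm (Fin n) K (r - i)))

/-- σ_i(x_1,…,x_m), viewed in K[x_1,…,x_m,y_1,…,y_n]. -/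
def sigmaX (K : Type*) [CommSemiring K] (m n i : ℕ) : MvPolynomial (Fin m ⊕ Fin n) K :=
  MvPolynomial.rename Sum.inl (MvPolynomial.esymm (Fin m) K i)

/-- σ_j(y_1,…,y_n), viewed in K[x_1,…,x_m,y_1,…,y_n]. -/
def sigmaY (K : Type*) [CommSemiring K] (m n j : ℕ) : MvPolynomial (Fin m ⊕ Fin n) K :=
  MvPolynomial.rename Sum.inr (MvPolynomial.esymm (Fin n) K j)

/-- The generators of the algebra `A_ns(m|n)` of nice supersymmetric polynomials:
`c_r` (r ≥ 0), `σ_i(x)^p` (1 ≤ i ≤ m), `σ_j(y)^p` (1 ≤ j ≤ n) and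
`u_k = σ_m(x)^k σ_n(y)^{p-k}` (0 < k < p). -/
def nsGens (K : Type*) [CommRing K] (p m n : ℕ) : Set (MvPolynomial (Fin m ⊕ Fin n) K) :=
  {f | ∃ r : ℕ, f = cpoly K m n r} ∪
  {f | ∃ i : ℕ, 1 ≤ i ∧ i ≤ m ∧ f = (sigmaX K m n i) ^ p} ∪
  {f | ∃ j : ℕ, 1 ≤ j ∧ j ≤ n ∧ f = (sigmaY K m n j) ^ p} ∪
  {f | ∃ k : ℕ, 0 < k ∧ k < p ∧ f = (sigmaX K m n m) ^ k * (sigmaY K m n n) ^ (p - k)}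

/-- The evaluation morphism `p_e` sending `x_i ↦ x_i` (i ≤ m), `y_j ↦ y_j` (j ≤ n) and the
remaining variables to `0`. -/
def pe (K : Type*) [CommSemiring K] (M N m n : ℕ) :
    MvPolynomial (Fin M ⊕ Fin N) K →ₐ[K] MvPolynomial (Fin m ⊕ Fin n) K :=
  MvPolynomial.aeval (Sum.elim
    (fun i : Fin M => if h : (i : ℕ) < m then MvPolynomial.X (Sum.inl ⟨(i : ℕ), h⟩) else 0)
    (fun j : Fin N => if h : (j : ℕ) < n then MvPolynomial.X (Sum.inr ⟨(j : ℕ), h⟩) else 0))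

end

noncomputable section

/-- A homogeneous polynomial is `p`-balanced if `p ∣ λ_i + λ_j` for every exponent vector `λ`
occurring in it, every `x`-index `i` and every `y`-index `j`. -/
def IsPBalanced (K : Type*) [CommSemiring K] (p m n : ℕ)
    (f : MvPolynomial (Fin m ⊕ Fin n) K) : Prop :=
  (∃ d : ℕ, f.IsHomogeneous d) ∧
  ∀ lam ∈ f.support, ∀ i : Fin m, ∀ j : Fin n, p ∣ lam (Sum.inl i) + lam (Sum.inr j)

section GeneratingSeries

variable {R S : Type*} [CommRing R] [CommRing S] {ι κ : Type*} [Fintype ι] [Fintype κ]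

/-- The generating series `∏ (1 + v_i t)` of the elementary symmetric functions of a family. -/
def elemSeries (v : ι → R) : PowerSeries R :=
  ∏ i, (1 + PowerSeries.C (v i) * PowerSeries.X)

/-- The series `∏ (1 + x_i t) / ∏ (1 + y_j t)`. -/
def superSeries (x : ι → R) (y : κ → R) : PowerSeries R :=
  elemSeries x * PowerSeries.invOfUnit (elemSeries y) 1

lemma constantCoeff_elemSeries (v : ι → R) :
    PowerSeries.constantCoeff (elemSeries v) = 1 := by
  simp [elemSeries, map_prod]

lemma superSeries_mul (x : ι → R) (y : κ → R) :
    superSeries x y * elemSeries y = elemSeries x := by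
  rw [superSeries, mul_assoc, PowerSeries.invOfUnit_mul _ _ (by simp [constantCoeff_elemSeries]),
    mul_one]

lemma isUnit_elemSeries (v : ι → R) : IsUnit (elemSeries v) := by
  rw [PowerSeries.isUnit_iff_constantCoeff, constantCoeff_elemSeries]
  exact isUnit_one

lemma eq_superSeries {x : ι → R} {y : κ → R} {g : PowerSeries R}
    (h : g * elemSeries y = elemSeries x) : g = superSeries x y :=
  (isUnit_elemSeries y).mul_right_cancel (h.trans (superSeries_mul x y).symm)

lemma map_elemSeries (φ : R →+* S) (v : ι → R) :
    PowerSeries.map φ (elemSeries v) = elemSeries (fun i => φ (v i)) := by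
  simp [elemSeries, map_prod]

lemma map_superSeries (φ : R →+* S) (x : ι → R) (y : κ → R) :
    PowerSeries.map φ (superSeries x y) =
      superSeries (fun i => φ (x i)) (fun j => φ (y j)) := by
  apply eq_superSeries
  rw [← map_elemSeries, ← map_elemSeries, ← map_mul, superSeries_mul]

lemma elemSeries_comp_equiv (e : κ ≃ ι) (v : ι → R) :
    elemSeries (fun k => v (e k)) = elemSeries v :=
  e.prod_comp (fun i => 1 + PowerSeries.C (v i) * PowerSeries.X)

lemma elemSeries_sumElim (v : ι → R) (w : κ → R) :
    elemSeries (Sum.elim v w) = elemSeries v * elemSeries w := by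
  simp [elemSeries, Fintype.prod_sum_type]

lemma coeff_elemSeries (v : ι → R) (r : ℕ) :
    PowerSeries.coeff r (elemSeries v) =
      ∑ t ∈ Finset.powersetCard r Finset.univ, ∏ i ∈ t, v i := by
  classical
  have h (t : Finset ι) : PowerSeries.coeff r
      (∏ i ∈ t, (PowerSeries.C (v i) * PowerSeries.X)) =
        if t.card = r then ∏ i ∈ t, v i else 0 := by
    rw [Finset.prod_mul_distrib, ← map_prod, Finset.prod_const, PowerSeries.coeff_C_mul,
      PowerSeries.coeff_X_pow]
    simp [eq_comm]
  rw [elemSeries, Finset.prod_one_add, map_sum]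
  simp_rw [h]
  rw [← Finset.sum_filter]
  congr 1
  ext t
  simp [Finset.mem_powersetCard]

lemma coeff_elemSeries_X (K : Type*) [CommRing K] (r : ℕ) :
    PowerSeries.coeff r (elemSeries (X : ι → MvPolynomial ι K)) = esymm ι K r := by
  rw [coeff_elemSeries, esymm]

lemma coeff_elemSeries_eq_aeval (K : Type*) [CommRing K] [Algebra K R] (v : ι → R) (r : ℕ) :
    PowerSeries.coeff r (elemSeries v) = aeval v (esymm ι K r) := by
  rw [← coeff_elemSeries_X]
  have := congrArg (PowerSeries.coeff r)
    (map_elemSeries (aeval (R := K) v).toRingHom (X : ι → MvPolynomial ι K))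
  simpa using this.symm

lemma prod_geometric_eq_invOfUnit (v : ι → R) :
    PowerSeries.invOfUnit (elemSeries v) 1 = ∏ i, PowerSeries.mk (fun k => (-v i) ^ k) := by
  apply (isUnit_elemSeries v).mul_right_cancel
  rw [PowerSeries.invOfUnit_mul _ _ (by simp [constantCoeff_elemSeries]), elemSeries,
    ← Finset.prod_mul_distrib]
  symm
  apply Finset.prod_eq_one
  intro i _
  ext k
  cases k with
  | zero => simp
  | succ k =>
    rw [mul_add, mul_one, ← mul_assoc, map_add, PowerSeries.coeff_succ_mul_X,
      mul_comm _ (PowerSeries.C _), PowerSeries.coeff_C_mul, PowerSeries.coeff_one]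
    simp
    ring

lemma coeff_invOfUnit_elemSeries_X (K : Type*) [CommRing K] [DecidableEq ι] (r : ℕ) :
    PowerSeries.coeff r (PowerSeries.invOfUnit (elemSeries (X : ι → MvPolynomial ι K)) 1) =
      (-1) ^ r * hsymm ι K r := by
  let _ : Fintype {P : ι →₀ ℕ // P.sum (fun _ => id) = r} :=
    Fintype.ofEquiv _ (Sym.equivNatSum ι r)
  rw [prod_geometric_eq_invOfUnit, PowerSeries.coeff_prod, hsymm, Finset.mul_sum,
    ← Equiv.sum_comp (Sym.equivNatSum ι r).symm]
  rw [Finset.sum_subtype (p := fun P : ι →₀ ℕ => P.sum (fun _ => id) = r) _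
    (by intro l; simp [Finsupp.sum_fintype])]
  apply Finset.sum_congr rfl
  rintro ⟨P, hP⟩ _
  have h1 : ((Sym.equivNatSum ι r).symm ⟨P, hP⟩ : Sym ι r).1 = Finsupp.toMultiset P := rfl
  rw [h1, Finsupp.toMultiset_map, Finsupp.prod_toMultiset, Finsupp.prod_mapDomain_index (by simp)
    (by intros; rw [pow_add])]
  simp only [PowerSeries.coeff_mk]
  rw [Finsupp.prod_fintype _ _ (by simp)]
  have h2 : r = ∑ i, P i := by
    rw [← hP, Finsupp.sum_fintype _ _ (by simp)]; rfl
  rw [h2, ← Finset.prod_pow_eq_pow_sum, ← Finset.prod_mul_distrib]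
  apply Finset.prod_congr rfl
  intro i _
  rw [← mul_pow, neg_one_mul]

end GeneratingSeries

lemma cpoly_eq_coeff (K : Type*) [CommRing K] (m n r : ℕ) :
    cpoly K m n r = PowerSeries.coeff r (superSeries
      (fun i : Fin m => (X (Sum.inl i) : MvPolynomial (Fin m ⊕ Fin n) K))
      (fun j : Fin n => X (Sum.inr j))) := by
  have hx := map_elemSeries (rename (R := K) (Sum.inl : Fin m → Fin m ⊕ Fin n)).toRingHom
    (X : Fin m → MvPolynomial (Fin m) K)
  have hy : PowerSeries.map (rename (R := K) (Sum.inr : Fin n → Fin m ⊕ Fin n)).toRingHom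
      (PowerSeries.invOfUnit (elemSeries (X : Fin n → MvPolynomial (Fin n) K)) 1) =
        PowerSeries.invOfUnit (elemSeries
        (fun j : Fin n => (X (Sum.inr j) : MvPolynomial (Fin m ⊕ Fin n) K))) 1 := by
    apply (isUnit_elemSeries
      (fun j : Fin n => (X (Sum.inr j) : MvPolynomial (Fin m ⊕ Fin n) K))).mul_right_cancel
    rw [PowerSeries.invOfUnit_mul _ _ (by simp [constantCoeff_elemSeries])]
    have h := map_elemSeries (rename (R := K) (Sum.inr : Fin n → Fin m ⊕ Fin n)).toRingHom
      (X : Fin n → MvPolynomial (Fin n) K)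
    simp only [AlgHom.toRingHom_eq_coe, RingHom.coe_coe, rename_X] at h
    rw [← h, AlgHom.toRingHom_eq_coe, ← map_mul,
      PowerSeries.invOfUnit_mul _ _ (by simp [constantCoeff_elemSeries]), map_one]
  simp only [AlgHom.toRingHom_eq_coe, RingHom.coe_coe, rename_X] at hx
  rw [superSeries, ← hx, ← hy, PowerSeries.coeff_mul,
    Finset.Nat.sum_antidiagonal_eq_sum_range_succ_mk, cpoly]
  have hsub : Finset.range (min r m + 1) ⊆ Finset.range (r + 1) := by
    intro i; simp only [Finset.mem_range]; omega
  rw [← Finset.sum_subset hsub]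
  · apply Finset.sum_congr rfl
    intro i _
    simp only [PowerSeries.coeff_map, coeff_elemSeries_X, coeff_invOfUnit_elemSeries_X]
    simp
    ring
  · intro i hi hi'
    simp only [PowerSeries.coeff_map, coeff_elemSeries_X]
    rw [esymm, Finset.powersetCard_eq_empty.2]
    · simp
    · simp only [Finset.mem_range] at hi hi'
      rw [Finset.card_univ, Fintype.card_fin]; omega

section DifferenceProduct

variable {R : Type*} [CommRing R] {ι : Type*}

lemma geometric_mul (a : R) :
    PowerSeries.mk (fun k => (-a) ^ k) * (1 + PowerSeries.C a * PowerSeries.X) = 1 := by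
  have h := prod_geometric_eq_invOfUnit (fun _ : Unit => a)
  have h' := PowerSeries.invOfUnit_mul (elemSeries (fun _ : Unit => a)) 1
    (by simp [constantCoeff_elemSeries])
  rw [h] at h'
  simpa [elemSeries] using h'

lemma coeff_prod_mul_geometric (x : ι → R) (a : R) (s : Finset ι) (k : ℕ) :
    PowerSeries.coeff (s.card + k) ((∏ i ∈ s, (1 + PowerSeries.C (x i) * PowerSeries.X)) *
      PowerSeries.mk (fun k => (-a) ^ k)) = (-a) ^ k * ∏ i ∈ s, (x i - a) := by
  classical
  induction s using Finset.induction_on generalizing k with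
  | empty => simp
  | insert i s hi ih =>
    rw [Finset.prod_insert hi, Finset.prod_insert hi, Finset.card_insert_of_notMem hi]
    have h1 := ih (k + 1)
    have h2 := ih k
    set g := (∏ i ∈ s, (1 + PowerSeries.C (x i) * PowerSeries.X)) *
      PowerSeries.mk (fun k => (-a) ^ k) with hg
    rw [mul_assoc, ← hg, add_mul, one_mul, map_add, mul_assoc, PowerSeries.coeff_C_mul,
      show s.card + 1 + k = s.card + k + 1 by ring, mul_comm PowerSeries.X,
      PowerSeries.coeff_succ_mul_X, h2, add_assoc, h1]
    ring

lemma coeff_prod_eq_zero_of_card_lt (y : ι → R) (s : Finset ι) (r : ℕ) (h : s.card < r) :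
    PowerSeries.coeff r (∏ i ∈ s, (1 + PowerSeries.C (y i) * PowerSeries.X)) = 0 := by
  classical
  induction s using Finset.induction_on generalizing r with
  | empty =>
    rw [Finset.prod_empty, PowerSeries.coeff_one, if_neg]
    rintro rfl
    simp at h
  | insert i s hi ih =>
    rw [Finset.card_insert_of_notMem hi] at h
    obtain ⟨r, rfl⟩ := Nat.exists_eq_succ_of_ne_zero (by omega : r ≠ 0)
    rw [Finset.prod_insert hi, add_mul, one_mul, map_add, mul_assoc, PowerSeries.coeff_C_mul,
      mul_comm PowerSeries.X, PowerSeries.coeff_succ_mul_X, ih _ (by omega), ih _ (by omega)]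
    simp

/-- The matrix of coefficients whose columns are shifts of the series `g`. -/
def shiftMatrix {c : ℕ} (g : PowerSeries R) (d : Fin c → ℕ) : Matrix (Fin c) (Fin c) R :=
  Matrix.of fun i j => PowerSeries.coeff (d i) (PowerSeries.X ^ (j : ℕ) * g)

/-- The matrix of coefficients of the products `∏_{l' ≠ l} (1 + y_{l'} t)`. -/
def cofactorMatrix {c : ℕ} (y : Fin c → R) : Matrix (Fin c) (Fin c) R :=
  Matrix.of fun j l => PowerSeries.coeff (j : ℕ)
    (∏ l' ∈ Finset.univ.erase l, (1 + PowerSeries.C (y l') * PowerSeries.X))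

variable [Fintype ι]

lemma shiftMatrix_mul_cofactorMatrix {c : ℕ} (x : ι → R) (y : Fin c → R) (k : Fin c → ℕ) :
    shiftMatrix (superSeries x y) (fun i => Fintype.card ι + k i) * cofactorMatrix y =
      Matrix.of fun i l => (-y l) ^ k i * ∏ a, (x a - y l) := by
  ext i l
  set q := ∏ l' ∈ Finset.univ.erase l, (1 + PowerSeries.C (y l') * PowerSeries.X) with hq
  have hqsum : q = ∑ j : Fin c, PowerSeries.C (PowerSeries.coeff (j : ℕ) q) *
      PowerSeries.X ^ (j : ℕ) := by
    ext r
    rw [map_sum]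
    simp only [PowerSeries.coeff_C_mul, PowerSeries.coeff_X_pow, mul_ite, mul_one, mul_zero]
    by_cases hr : r < c
    · rw [Finset.sum_eq_single (⟨r, hr⟩ : Fin c)]
      · simp
      · intro b _ hb
        rw [if_neg]
        rintro rfl
        exact hb rfl
      · simp
    · rw [Finset.sum_eq_zero, hq, coeff_prod_eq_zero_of_card_lt]
      · have := l.2
        rw [Finset.card_erase_of_mem (Finset.mem_univ _), Finset.card_univ, Fintype.card_fin]
        omega
      · intro b _
        have := b.2
        rw [if_neg (by omega)]
  have hprod : q * superSeries x y = elemSeries x * PowerSeries.mk (fun k => (-y l) ^ k) := by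
    have h1 : (1 + PowerSeries.C (y l) * PowerSeries.X) * q = elemSeries y :=
      Finset.mul_prod_erase _ (fun l => 1 + PowerSeries.C (y l) * PowerSeries.X)
        (Finset.mem_univ l)
    rw [← superSeries_mul x y, ← h1]
    linear_combination (-(q * superSeries x y)) * geometric_mul (y l)
  have h2 := coeff_prod_mul_geometric x (y l) Finset.univ (k i)
  rw [Finset.card_univ] at h2
  rw [Matrix.of_apply, ← h2, ← elemSeries, ← hprod]
  conv_rhs => rw [hqsum]
  rw [Finset.sum_mul, map_sum, Matrix.mul_apply]
  apply Finset.sum_congr rfl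
  intro j _
  rw [mul_assoc, PowerSeries.coeff_C_mul, mul_comm]
  rfl

lemma det_cofactorMatrix {c : ℕ} (y : Fin c → R) :
    (cofactorMatrix y).det = (Matrix.vandermonde (fun l => -y l)).det := by
  have h := congrArg Matrix.det
    (shiftMatrix_mul_cofactorMatrix (fun a : Empty => a.elim) y (fun i => (i : ℕ)))
  rw [Matrix.det_mul, Matrix.det_of_isLowerTriangular] at h
  · rw [← Matrix.det_transpose (Matrix.vandermonde _)]
    convert h using 1
    · rw [Finset.prod_eq_one, one_mul]
      intro i _
      rw [shiftMatrix, Matrix.of_apply, PowerSeries.coeff_X_pow_mul']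
      simp [superSeries, constantCoeff_elemSeries, PowerSeries.constantCoeff_invOfUnit]
    · congr 1
      ext i l
      simp [Matrix.vandermonde]
  · intro i j hij
    rw [shiftMatrix, Matrix.of_apply, PowerSeries.coeff_X_pow_mul', if_neg]
    have : i < j := hij
    simpa using this

lemma det_mul_aeval_of_isSymmetric {K : Type*} [CommRing K] [Algebra K R] {c : ℕ} (y : Fin c → R)
    {f : MvPolynomial (Fin c) K} (hf : f.IsSymmetric) :
    (Matrix.vandermonde (fun l => -y l)).det * aeval y f =
      ∑ μ ∈ f.support, f.coeff μ • ((-1) ^ (∑ i, μ i) *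
        (Matrix.of fun i l : Fin c => (-y l) ^ (μ i + i)).det) := by
  have hσ (σ : Equiv.Perm (Fin c)) : aeval y f =
      ∑ μ ∈ f.support, f.coeff μ • ∏ i, y (σ i) ^ μ i := by
    conv_lhs => rw [← hf σ, aeval_rename]
    rw [aeval_def, eval₂_eq']
    simp [Algebra.smul_def]
  rw [Matrix.det_apply', Finset.sum_mul,
    Finset.sum_congr rfl fun σ _ => by rw [hσ σ, Finset.mul_sum], Finset.sum_comm]
  apply Finset.sum_congr rfl
  intro μ _
  rw [← Matrix.det_transpose (Matrix.of _), Matrix.det_apply', Finset.mul_sum, Finset.smul_sum]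
  apply Finset.sum_congr rfl
  intro σ _
  simp only [Matrix.vandermonde_apply, Matrix.transpose_apply, Matrix.of_apply, pow_add,
    Finset.prod_mul_distrib]
  rw [mul_smul_comm]
  congr 1
  have : ∏ i, y (σ i) ^ μ i = (-1) ^ (∑ i, μ i) * ∏ i, (-y (σ i)) ^ μ i := by
    rw [← Finset.prod_pow_eq_pow_sum, ← Finset.prod_mul_distrib]
    apply Finset.prod_congr rfl
    intro i _
    rw [← mul_pow]
    simp
  rw [this]
  ring

/-- The subalgebra generated by the coefficients of a power series. -/
def coeffAlgebra (K : Type*) [CommRing K] [Algebra K R] (g : PowerSeries R) : Subalgebra K R :=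
  Algebra.adjoin K (Set.range fun r => PowerSeries.coeff r g)

lemma coeff_mem_coeffAlgebra (K : Type*) [CommRing K] [Algebra K R] (g : PowerSeries R) (r : ℕ) :
    PowerSeries.coeff r g ∈ coeffAlgebra K g :=
  Algebra.subset_adjoin ⟨r, rfl⟩

/-- The product of all differences `x_i - y_j`. -/
def diffProd {κ : Type*} [Fintype κ] (x : ι → R) (y : κ → R) : R :=
  ∏ j, ∏ i, (x i - y j)

lemma exists_isSymmetric_of_mem_coeffAlgebra {K : Type*} [CommRing K] [Algebra K R] (y : ι → R)
    {z : R} (hz : z ∈ coeffAlgebra K (elemSeries y)) :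
    ∃ f : MvPolynomial ι K, f.IsSymmetric ∧ z = aeval y f := by
  have : coeffAlgebra K (elemSeries y) ≤ (symmetricSubalgebra ι K).map (aeval y) := by
    apply Algebra.adjoin_le
    rintro _ ⟨r, rfl⟩
    exact ⟨esymm ι K r, esymm_isSymmetric ι K r, (coeff_elemSeries_eq_aeval K y r).symm⟩
  obtain ⟨f, hf, rfl⟩ := this hz
  exact ⟨f, hf, rfl⟩

lemma det_mem {K : Type*} [CommRing K] [Algebra K R] {c : ℕ} (A : Subalgebra K R)
    (M : Matrix (Fin c) (Fin c) R) (h : ∀ i j, M i j ∈ A) : M.det ∈ A := by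
  rw [Matrix.det_apply]
  exact A.sum_mem fun σ _ => by
    rw [Units.smul_def]
    exact A.zsmul_mem (A.prod_mem fun i _ => h _ _) _

/-- The products `∏ (x_i - y_j) z`, with `z` symmetric in the `y_j`, are polynomials in the
coefficients of `superSeries x y`. -/
lemma diffProd_mul_mem_of_mem {K : Type*} [CommRing K] [Algebra K R] [IsDomain R] {c : ℕ}
    (x : ι → R) {y : Fin c → R} (hy : Function.Injective y) {z : R}
    (hz : z ∈ coeffAlgebra K (elemSeries y)) :
    diffProd x y * z ∈ coeffAlgebra K (superSeries x y) := by
  obtain ⟨f, hf, rfl⟩ := exists_isSymmetric_of_mem_coeffAlgebra y hz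
  set V := (Matrix.vandermonde (fun l => -y l)).det with hV
  have hV0 : V ≠ 0 := Matrix.det_vandermonde_ne_zero_iff.2 (neg_injective.comp hy)
  have hdet (k : Fin c → ℕ) : diffProd x y * (Matrix.of fun i l : Fin c => (-y l) ^ k i).det =
      V * (shiftMatrix (superSeries x y) (fun i => Fintype.card ι + k i)).det := by
    rw [hV, ← det_cofactorMatrix, mul_comm (Matrix.det _), ← Matrix.det_mul,
      shiftMatrix_mul_cofactorMatrix, diffProd]
    exact (Matrix.det_mul_row _ _).symm.trans (by
      congr 1; ext i j; simp [mul_comm])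
  have key : diffProd x y * aeval y f = ∑ μ ∈ f.support, f.coeff μ • ((-1) ^ (∑ i, μ i) *
      (shiftMatrix (superSeries x y) (fun i => Fintype.card ι + (μ i + i))).det) := by
    apply mul_left_cancel₀ hV0
    rw [mul_left_comm, hV, det_mul_aeval_of_isSymmetric y hf, ← hV, Finset.mul_sum, Finset.mul_sum]
    apply Finset.sum_congr rfl
    intro μ _
    rw [mul_smul_comm, mul_smul_comm, mul_left_comm, hdet (fun i => μ i + i), mul_left_comm]
  rw [key]
  refine Subalgebra.sum_mem _ fun μ _ => Subalgebra.smul_mem _ (Subalgebra.mul_mem _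
    (Subalgebra.pow_mem _ (Subalgebra.neg_mem _ (Subalgebra.one_mem _)) _)
    (det_mem _ _ fun i j => ?_)) _
  rw [shiftMatrix, Matrix.of_apply, PowerSeries.coeff_X_pow_mul']
  split_ifs
  · exact coeff_mem_coeffAlgebra _ _ _
  · exact Subalgebra.zero_mem _

/-- The products `∏ (x_i - y_j) z`, with `z` symmetric in the `x_i` and in the `y_j`, are
polynomials in the coefficients of `superSeries x y`. -/
lemma diffProd_mul_mem {K : Type*} [CommRing K] [Algebra K R] [IsDomain R] {c : ℕ}
    (x : ι → R) {y : Fin c → R} (hy : Function.Injective y) {z : R}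
    (hz : z ∈ coeffAlgebra K (elemSeries x) ⊔ coeffAlgebra K (elemSeries y)) :
    diffProd x y * z ∈ coeffAlgebra K (superSeries x y) := by
  have hle : coeffAlgebra K (elemSeries x) ⊔ coeffAlgebra K (elemSeries y) ≤
      coeffAlgebra K (superSeries x y) ⊔ coeffAlgebra K (elemSeries y) := by
    refine sup_le (Algebra.adjoin_le ?_) le_sup_right
    rintro _ ⟨r, rfl⟩
    simp only
    rw [SetLike.mem_coe, ← superSeries_mul x y, PowerSeries.coeff_mul]
    refine Subalgebra.sum_mem _ fun ij _ => Subalgebra.mul_mem _ ?_ ?_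
    · exact le_sup_left (α := Subalgebra K R) (coeff_mem_coeffAlgebra _ _ _)
    · exact le_sup_right (α := Subalgebra K R) (coeff_mem_coeffAlgebra _ _ _)
  have hz' := hle hz
  clear hz
  rw [coeffAlgebra, coeffAlgebra, ← Algebra.adjoin_union, ← Subalgebra.mem_toSubmodule,
    Algebra.adjoin_union_coe_submodule] at hz'
  induction hz' using Submodule.mul_induction_on' with
  | mem_mul_mem a ha b hb =>
    rw [mul_left_comm]
    exact Subalgebra.mul_mem _ ha (diffProd_mul_mem_of_mem x hy hb)
  | add a _ b _ iha ihb =>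
    rw [mul_add]
    exact Subalgebra.add_mem _ iha ihb

end DifferenceProduct

/-- Symmetric functions of a further family `w` can be absorbed into a subalgebra that only
contains the elementary symmetric functions of the union of `w` with a family `x'`. -/
lemma diffProd_mul_mem_of_union {K R : Type*} [CommRing K] [CommRing R] [Algebra K R] [IsDomain R]
    {α β ι : Type*} [Fintype α] [Fintype β] [Fintype ι] {c : ℕ}
    (w : α → R) (x' : β → R) (x : ι → R) {y : Fin c → R} (hy : Function.Injective y)
    (hx' : coeffAlgebra K (elemSeries x') ≤ coeffAlgebra K (elemSeries x))
    {L : Subalgebra K R} (hL : coeffAlgebra K (superSeries x y) ≤ L)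
    (hL' : coeffAlgebra K (elemSeries w * elemSeries x') ≤ L) {z : R}
    (hz : z ∈ coeffAlgebra K (elemSeries w) ⊔
      (coeffAlgebra K (elemSeries x) ⊔ coeffAlgebra K (elemSeries y))) :
    diffProd x y * z ∈ L := by
  set B := coeffAlgebra K (elemSeries x) ⊔ coeffAlgebra K (elemSeries y) with hB
  have hw : ∀ q ∈ coeffAlgebra K (elemSeries w),
      ∀ u, (∀ z ∈ B, diffProd x y * (u * z) ∈ L) → ∀ z ∈ B, diffProd x y * (q * u * z) ∈ L := by
    intro q hq
    refine Algebra.adjoin_induction ?_ ?_ ?_ ?_ hq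
    · rintro _ ⟨j, rfl⟩
      simp only
      induction j using Nat.strong_induction_on with
      | _ j ih =>
        intro u hu z hz
        have h1 : PowerSeries.coeff j (elemSeries w * elemSeries x') =
            (∑ i ∈ Finset.range j, PowerSeries.coeff i (elemSeries w) *
              PowerSeries.coeff (j - i) (elemSeries x')) + PowerSeries.coeff j (elemSeries w) := by
          rw [PowerSeries.coeff_mul, Finset.Nat.sum_antidiagonal_eq_sum_range_succ_mk,
            Finset.sum_range_succ]
          simp [constantCoeff_elemSeries]
        have h2 : diffProd x y * (PowerSeries.coeff j (elemSeries w) * u * z) =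
            PowerSeries.coeff j (elemSeries w * elemSeries x') * (diffProd x y * (u * z)) -
            ∑ i ∈ Finset.range j, diffProd x y * (PowerSeries.coeff i (elemSeries w) * u *
              (PowerSeries.coeff (j - i) (elemSeries x') * z)) := by
          rw [h1, add_mul, Finset.sum_mul, add_sub_right_comm, ← Finset.sum_sub_distrib,
            Finset.sum_eq_zero fun i _ => by ring]
          ring
        rw [h2]
        refine Subalgebra.sub_mem _ (Subalgebra.mul_mem _ (hL' (coeff_mem_coeffAlgebra _ _ _))
          (hu z hz)) (Subalgebra.sum_mem _ fun i hi => ih i (Finset.mem_range.1 hi) u hu _ ?_)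
        exact Subalgebra.mul_mem _ (le_sup_left (α := Subalgebra K R)
          (hx' (coeff_mem_coeffAlgebra _ _ _))) hz
    · intro r u hu z hz
      rw [mul_assoc, ← Algebra.smul_def, mul_smul_comm]
      exact Subalgebra.smul_mem _ (hu z hz) _
    · intro q r _ _ hq hr u hu z hz
      rw [add_mul, add_mul, mul_add]
      exact Subalgebra.add_mem _ (hq u hu z hz) (hr u hu z hz)
    · intro q r _ _ hq hr u hu z hz
      rw [mul_assoc q]
      exact hq _ (hr u hu) z hz
  rw [coeffAlgebra, hB, coeffAlgebra, coeffAlgebra, ← Algebra.adjoin_union,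
    ← Algebra.adjoin_union, ← Subalgebra.mem_toSubmodule, Algebra.adjoin_union_coe_submodule] at hz
  induction hz using Submodule.mul_induction_on' with
  | mem_mul_mem a ha b hb =>
    rw [← mul_one a]
    refine hw a ha 1 (fun z hz => ?_) b ?_
    · rw [one_mul]
      exact hL (diffProd_mul_mem x hy hz)
    · rwa [hB, coeffAlgebra, coeffAlgebra, ← Algebra.adjoin_union]
  | add a _ b _ iha ihb =>
    rw [mul_add]
    exact Subalgebra.add_mem _ iha ihb

lemma mem_range_of_dvd {K α τ : Type*} [CommRing K] {q : ℕ} (f : MvPolynomial (α ⊕ τ) K)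
    (hdvd : ∀ m ∈ f.support, ∀ t, q ∣ m (Sum.inl t)) :
    ∃ f' : MvPolynomial (α ⊕ τ) K,
      f = aeval (Sum.elim (fun t => X (Sum.inl t) ^ q) (fun t => X (Sum.inr t))) f' := by
  suffices f ∈ (aeval (R := K) (Sum.elim (fun t => (X (Sum.inl t) : MvPolynomial (α ⊕ τ) K) ^ q)
      (fun t => X (Sum.inr t)))).range by
    obtain ⟨f', hf'⟩ := this
    exact ⟨f', hf'.symm⟩
  rw [f.as_sum]
  refine Subalgebra.sum_mem _ fun m hm => ?_
  rw [monomial_eq]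
  refine Subalgebra.mul_mem _ ⟨C (coeff m f), by simp⟩ (Subalgebra.prod_mem _ fun i _ => ?_)
  rcases i with t | t
  · obtain ⟨d, hd⟩ := hdvd m hm t
    exact ⟨X (Sum.inl t) ^ d, by simp [hd, pow_mul]⟩
  · exact ⟨X (Sum.inr t) ^ m (Sum.inr t), by simp⟩

lemma map_esymmAlgHom {S T : Type*} [CommRing S] [CommRing T] (φ : S →+* T) (k : ℕ)
    (Q : MvPolynomial (Fin k) S) :
    (esymmAlgHom (Fin k) T k (map φ Q)).val = map φ (esymmAlgHom (Fin k) S k Q).val := by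
  rw [esymmAlgHom_apply, esymmAlgHom_apply]
  induction Q using MvPolynomial.induction_on with
  | C a => simp
  | add f g hf hg => simp only [map_add, hf, hg]
  | mul_X f i hf => simp only [map_mul, map_X, aeval_X, map_esymm, hf]

lemma mem_of_symmetric_block {K τ : Type*} [CommRing K] {k q : ℕ} (hq : q ≠ 0)
    {f : MvPolynomial (Fin k ⊕ τ) K}
    (hf : ∀ σ : Equiv.Perm (Fin k), rename (Sum.map σ id) f = f)
    (hdvd : ∀ m ∈ f.support, ∀ t, q ∣ m (Sum.inl t))
    (P : Set (τ → τ)) (hP : ∀ w ∈ P, rename (Sum.map id w) f = f)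
    {A : Subalgebra K (MvPolynomial (Fin k ⊕ τ) K)}
    (hA : ∀ i, aeval (fun t => X (Sum.inl t) ^ q) (esymm (Fin k) K i) ∈ A)
    (hA' : ∀ h : MvPolynomial τ K, (∀ w ∈ P, rename w h = h) → rename Sum.inr h ∈ A) :
    f ∈ A := by
  obtain ⟨f', rfl⟩ := mem_range_of_dvd f hdvd
  set Φ := sumAlgEquiv K (Fin k) τ with hΦ
  set fr := aeval (R := K) (Sum.elim (fun t => (X (Sum.inl t) : MvPolynomial (Fin k ⊕ τ) K) ^ q)
      (fun t => X (Sum.inr t)))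
  have hfr : Φ (fr f') = expand q (Φ f') := by
    have : Φ.toAlgHom.comp fr =
        ((expand q).restrictScalars K).comp Φ.toAlgHom := by
      ext t : 1
      rcases t with t | t <;> simp [fr, Φ]
    exact DFunLike.congr_fun this f'
  have hΦσ (σ : Equiv.Perm (Fin k)) (g) : Φ (rename (Sum.map σ id) g) = rename σ (Φ g) := by
    have : Φ.toAlgHom.comp (rename (Sum.map σ id)) =
        ((rename σ).restrictScalars K).comp Φ.toAlgHom := by
      ext t : 1
      rcases t with t | t <;> simp [Φ]
    exact DFunLike.congr_fun this g
  have hΦw (w : τ → τ) (g) : Φ (rename (Sum.map id w) g) =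
      map (rename (R := K) w).toRingHom (Φ g) := by
    have : Φ.toAlgHom.comp (rename (Sum.map id w)) =
        (mapAlgHom (rename (R := K) w)).comp Φ.toAlgHom := by
      ext t : 1
      rcases t with t | t <;> simp [Φ]
    exact DFunLike.congr_fun this g
  have hinj := expand_injective (σ := Fin k) (R := MvPolynomial τ K) (Nat.pos_of_ne_zero hq)
  have hsym : (Φ f').IsSymmetric := by
    intro σ
    apply hinj
    rw [← rename_expand, ← hfr, ← hΦσ, hf]
  obtain ⟨Q, hQ⟩ := (esymmAlgHom_fin_bijective (MvPolynomial τ K) k).2 ⟨Φ f', hsym⟩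
  have hQw : ∀ w ∈ P, map (rename (R := K) w).toRingHom Q = Q := by
    intro w hw
    apply (esymmAlgHom_fin_bijective (MvPolynomial τ K) k).1
    apply Subtype.ext
    rw [map_esymmAlgHom, hQ]
    apply hinj
    simp only
    rw [← map_expand, ← hfr, ← hΦw, hP w hw]
  have hfQ : fr f' = Φ.symm (expand q (esymmAlgHom (Fin k) (MvPolynomial τ K) k Q).val) := by
    rw [hQ, ← hfr, AlgEquiv.symm_apply_apply]
  rw [hfQ, esymmAlgHom_apply, aeval_def, eval₂_eq', map_sum, map_sum]
  refine Subalgebra.sum_mem _ fun d _ => ?_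
  rw [map_mul, map_mul, map_prod, map_prod]
  refine Subalgebra.mul_mem _ ?_ (Subalgebra.prod_mem _ fun i _ => ?_)
  · rw [algebraMap_eq, expand_C]
    have : Φ.symm (C (coeff d Q)) = rename Sum.inr (coeff d Q) := by
      rw [AlgEquiv.symm_apply_eq]
      exact (DFunLike.congr_fun (sumAlgEquiv_comp_rename_inr (R := K) (S₁ := Fin k) (S₂ := τ))
        (coeff d Q)).symm
    rw [this]
    refine hA' _ fun w hw => ?_
    have := congrArg (coeff d) (hQw w hw)
    rwa [coeff_map] at this
  · rw [map_pow, map_pow]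
    refine Subalgebra.pow_mem _ ?_ _
    convert hA (i + 1) using 1
    rw [AlgEquiv.symm_apply_eq]
    simp [esymm, hΦ, map_sum, map_prod]

lemma map_coeffAlgebra {K R S : Type*} [CommRing K] [CommRing R] [CommRing S] [Algebra K R]
    [Algebra K S] (φ : R →ₐ[K] S) (g : PowerSeries R) :
    (coeffAlgebra K g).map φ = coeffAlgebra K (PowerSeries.map (φ : R →+* S) g) := by
  rw [coeffAlgebra, coeffAlgebra, AlgHom.map_adjoin, ← Set.range_comp]
  congr 1

lemma mem_coeffAlgebra_of_isSymmetric {K : Type*} [CommRing K] {c : ℕ}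
    {h : MvPolynomial (Fin c) K} (hs : h.IsSymmetric) :
    h ∈ coeffAlgebra K (elemSeries (X : Fin c → MvPolynomial (Fin c) K)) := by
  obtain ⟨Q, hQ⟩ := (esymmAlgHom_fin_bijective K c).2 ⟨h, hs⟩
  have hQ' : _ = h := congrArg Subtype.val hQ
  rw [esymmAlgHom_apply] at hQ'
  rw [← hQ', aeval_def, eval₂_eq']
  refine Subalgebra.sum_mem _ fun d _ => Subalgebra.mul_mem _ (Subalgebra.algebraMap_mem _ _)
    (Subalgebra.prod_mem _ fun i _ => Subalgebra.pow_mem _ ?_ _)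
  have := coeff_mem_coeffAlgebra K (elemSeries (X : Fin c → MvPolynomial (Fin c) K)) (i + 1)
  rwa [coeff_elemSeries_eq_aeval K, aeval_X_left_apply] at this

lemma mem_sup_coeffAlgebra_of_symmetric {K : Type*} [CommRing K] {b c : ℕ}
    {h : MvPolynomial (Fin b ⊕ Fin c) K}
    (h₁ : ∀ σ : Equiv.Perm (Fin b), rename (Sum.map σ id) h = h)
    (h₂ : ∀ σ : Equiv.Perm (Fin c), rename (Sum.map id σ) h = h) :
    h ∈ coeffAlgebra K (elemSeries fun i : Fin b =>
        (X (Sum.inl i) : MvPolynomial (Fin b ⊕ Fin c) K)) ⊔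
      coeffAlgebra K (elemSeries fun j : Fin c =>
        (X (Sum.inr j) : MvPolynomial (Fin b ⊕ Fin c) K)) := by
  refine mem_of_symmetric_block one_ne_zero h₁ (fun _ _ _ => one_dvd _)
    (Set.range fun σ : Equiv.Perm (Fin c) => (σ : Fin c → Fin c)) ?_ (fun i => ?_) fun g hg => ?_
  · rintro _ ⟨σ, rfl⟩
    exact h₂ σ
  · simp only [pow_one]
    rw [← coeff_elemSeries_eq_aeval]
    exact le_sup_left (α := Subalgebra K _) (coeff_mem_coeffAlgebra _ _ _)
  · have hg' := mem_coeffAlgebra_of_isSymmetric (h := g) fun σ => hg σ ⟨σ, rfl⟩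
    have := (Subalgebra.mem_map (f := rename (Sum.inr : Fin c → Fin b ⊕ Fin c))).2 ⟨g, hg', rfl⟩
    rw [map_coeffAlgebra, map_elemSeries] at this
    refine le_sup_right (α := Subalgebra K _) ?_
    simpa using this

lemma mem_sup_sup_coeffAlgebra_of_symmetric {K : Type*} [CommRing K] {k b c q : ℕ} (hq : q ≠ 0)
    {f : MvPolynomial (Fin k ⊕ (Fin b ⊕ Fin c)) K}
    (h₀ : ∀ σ : Equiv.Perm (Fin k), rename (Sum.map σ id) f = f)
    (h₁ : ∀ σ : Equiv.Perm (Fin b), rename (Sum.map id (Sum.map σ id)) f = f)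
    (h₂ : ∀ σ : Equiv.Perm (Fin c), rename (Sum.map id (Sum.map id σ)) f = f)
    (hdvd : ∀ m ∈ f.support, ∀ t, q ∣ m (Sum.inl t)) :
    f ∈ coeffAlgebra K (elemSeries fun t : Fin k =>
        (X (Sum.inl t) : MvPolynomial (Fin k ⊕ (Fin b ⊕ Fin c)) K) ^ q) ⊔
      (coeffAlgebra K (elemSeries fun i : Fin b =>
        (X (Sum.inr (Sum.inl i)) : MvPolynomial (Fin k ⊕ (Fin b ⊕ Fin c)) K)) ⊔
      coeffAlgebra K (elemSeries fun j : Fin c =>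
        (X (Sum.inr (Sum.inr j)) : MvPolynomial (Fin k ⊕ (Fin b ⊕ Fin c)) K))) := by
  refine mem_of_symmetric_block hq h₀ hdvd
    ((Set.range fun σ : Equiv.Perm (Fin b) => Sum.map σ id) ∪
      (Set.range fun σ : Equiv.Perm (Fin c) => Sum.map id σ)) ?_ (fun i => ?_) fun g hg => ?_
  · rintro _ (⟨σ, rfl⟩ | ⟨σ, rfl⟩)
    exacts [h₁ σ, h₂ σ]
  · rw [← coeff_elemSeries_eq_aeval]
    exact le_sup_left (α := Subalgebra K _) (coeff_mem_coeffAlgebra _ _ _)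
  · have hg' := mem_sup_coeffAlgebra_of_symmetric (h := g) (fun σ => hg _ (Or.inl ⟨σ, rfl⟩))
      fun σ => hg _ (Or.inr ⟨σ, rfl⟩)
    have := (Subalgebra.mem_map
      (f := rename (Sum.inr : Fin b ⊕ Fin c → Fin k ⊕ (Fin b ⊕ Fin c)))).2 ⟨g, hg', rfl⟩
    rw [Algebra.map_sup, map_coeffAlgebra, map_coeffAlgebra, map_elemSeries,
      map_elemSeries] at this
    refine le_sup_right (α := Subalgebra K _) ?_
    simpa using this

lemma elemSeries_ite {ι R : Type*} [CommRing R] [Fintype ι] (a : ι) (P : ι → Prop)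
    [DecidablePred P] (hP : ∀ i, P i ↔ i = a) (T : R) (v : ι → R) :
    elemSeries (fun i => if P i then T else v i) =
      (1 + PowerSeries.C T * PowerSeries.X) * elemSeries (fun i => if P i then 0 else v i) := by
  classical
  rw [elemSeries, elemSeries, ← Finset.mul_prod_erase _ _ (Finset.mem_univ a),
    ← Finset.mul_prod_erase _ _ (Finset.mem_univ a)]
  simp only [(hP a).2 rfl, if_true, map_zero, zero_mul, add_zero, one_mul]
  congr 1
  refine Finset.prod_congr rfl fun i hi => ?_
  have : ¬ P i := fun h => Finset.ne_of_mem_erase hi ((hP i).1 h)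
  simp [this]

/-- The algebra of supersymmetric polynomials. -/
def superAlgebra (K : Type*) [CommSemiring K] (m n : ℕ) :
    Subalgebra K (MvPolynomial (Fin m ⊕ Fin n) K) where
  carrier := {f | IsSupersymmetric K m n f}
  mul_mem' := fun {f g} hf hg => ⟨fun σ => by rw [map_mul, hf.1, hg.1],
    fun σ => by rw [map_mul, hf.2.1, hg.2.1],
    by rw [map_mul, Polynomial.derivative_mul, hf.2.2, hg.2.2, zero_mul, mul_zero, add_zero]⟩
  add_mem' := fun {f g} hf hg => ⟨fun σ => by rw [map_add, hf.1, hg.1],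
    fun σ => by rw [map_add, hf.2.1, hg.2.1],
    by rw [map_add, Polynomial.derivative_add, hf.2.2, hg.2.2, add_zero]⟩
  algebraMap_mem' := fun r => ⟨fun σ => by rw [AlgHom.commutes],
    fun σ => by rw [AlgHom.commutes],
    by rw [AlgHom.commutes]; exact Polynomial.derivative_C⟩

/-- The family `x` of variables. -/
abbrev xVar (K : Type*) [CommSemiring K] (m n : ℕ) (i : Fin m) :
    MvPolynomial (Fin m ⊕ Fin n) K :=
  X (Sum.inl i)

/-- The family `y` of variables. -/
abbrev yVar (K : Type*) [CommSemiring K] (m n : ℕ) (j : Fin n) :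
    MvPolynomial (Fin m ⊕ Fin n) K :=
  X (Sum.inr j)

lemma cpoly_mem_superAlgebra (K : Type*) [CommRing K] {m n : ℕ} (hm : 1 ≤ m) (hn : 1 ≤ n)
    (r : ℕ) : cpoly K m n r ∈ superAlgebra K m n := by
  rw [cpoly_eq_coeff]
  refine ⟨fun σ => ?_, fun σ => ?_, ?_⟩
  · have h := congrArg (PowerSeries.coeff r) (map_superSeries
      (rename (R := K) (Sum.map σ (id : Fin n → Fin n))).toRingHom (xVar K m n) (yVar K m n))
    rw [PowerSeries.coeff_map] at h
    refine h.trans ?_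
    simp only [AlgHom.toRingHom_eq_coe, RingHom.coe_coe, rename_X, Sum.map_inl, Sum.map_inr, id]
    rw [superSeries, elemSeries_comp_equiv σ (xVar K m n), superSeries]
  · have h := congrArg (PowerSeries.coeff r) (map_superSeries
      (rename (R := K) (Sum.map (id : Fin m → Fin m) σ)).toRingHom (xVar K m n) (yVar K m n))
    rw [PowerSeries.coeff_map] at h
    refine h.trans ?_
    simp only [AlgHom.toRingHom_eq_coe, RingHom.coe_coe, rename_X, Sum.map_inl, Sum.map_inr, id]
    rw [superSeries, elemSeries_comp_equiv σ (yVar K m n), superSeries]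
  · have h := congrArg (PowerSeries.coeff r) (map_superSeries
      (psiSub K m n).toRingHom (xVar K m n) (yVar K m n))
    rw [PowerSeries.coeff_map] at h
    have h' : superSeries (fun i => psiSub K m n (xVar K m n i))
        (fun j => psiSub K m n (yVar K m n j)) = PowerSeries.map Polynomial.C
        (superSeries (fun i : Fin m => if (i : ℕ) = m - 1 then 0 else xVar K m n i)
          (fun j : Fin n => if (j : ℕ) = n - 1 then 0 else yVar K m n j)) := by
      symm
      apply eq_superSeries
      simp only [psiSub, aeval_X, Sum.elim_inl, Sum.elim_inr]
      rw [elemSeries_ite (⟨m - 1, by omega⟩ : Fin m) _ (fun i => by rw [Fin.ext_iff]),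
        elemSeries_ite (⟨n - 1, by omega⟩ : Fin n) _ (fun i => by rw [Fin.ext_iff]),
        mul_left_comm]
      congr 1
      have h₁ := congrArg (PowerSeries.map (Polynomial.C (R := MvPolynomial (Fin m ⊕ Fin n) K)))
        (superSeries_mul (fun i : Fin m => if (i : ℕ) = m - 1 then 0 else xVar K m n i)
          (fun j : Fin n => if (j : ℕ) = n - 1 then 0 else yVar K m n j))
      rw [map_mul, map_elemSeries, map_elemSeries] at h₁
      simpa only [apply_ite Polynomial.C, Polynomial.C_0] using h₁
    have h'' := h.trans (congrArg (PowerSeries.coeff r) h')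
    rw [PowerSeries.coeff_map] at h''
    exact (congrArg Polynomial.derivative h'').trans Polynomial.derivative_C

lemma coeff_elemSeries_pow {ι R : Type*} [CommRing R] [Fintype ι] (p : ℕ) [ExpChar R p]
    (v : ι → R) (r : ℕ) :
    PowerSeries.coeff r (elemSeries fun i => v i ^ p) = PowerSeries.coeff r (elemSeries v) ^ p := by
  have h := congrArg (PowerSeries.coeff r) (map_elemSeries (frobenius R p) v)
  rw [PowerSeries.coeff_map, frobenius_def] at h
  simpa only [frobenius_def] using h.symm

lemma coeff_elemSeries_xVar {K : Type*} [CommRing K] (m n r : ℕ) :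
    PowerSeries.coeff r (elemSeries (xVar K m n)) = sigmaX K m n r := by
  rw [coeff_elemSeries_eq_aeval K, sigmaX,
    show aeval (xVar K m n) = rename Sum.inl by ext; simp [xVar]]

lemma isSupersymmetric_sigmaX_pow {K : Type*} [CommRing K] (p : ℕ) [CharP K p]
    (m n r : ℕ) : IsSupersymmetric K m n (sigmaX K m n r ^ p) := by
  refine ⟨fun σ => ?_, fun σ => ?_, ?_⟩
  · rw [map_pow, sigmaX, rename_rename,
      show Sum.map σ id ∘ Sum.inl = (Sum.inl : Fin m → Fin m ⊕ Fin n) ∘ σ from rfl,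
      ← rename_rename, rename_esymm]
  · rw [map_pow, sigmaX, rename_rename,
      show Sum.map id σ ∘ Sum.inl = (Sum.inl : Fin m → Fin m ⊕ Fin n) from rfl]
  · rw [map_pow, Polynomial.derivative_pow, CharP.cast_eq_zero]
    simp

lemma isPBalanced_sigmaX_pow {K : Type*} [CommRing K] (p : ℕ) [Fact p.Prime] [CharP K p]
    (m n r : ℕ) : IsPBalanced K p m n (sigmaX K m n r ^ p) := by
  have hh : (esymm (Fin m) K r).IsHomogeneous r := by
    refine IsHomogeneous.sum _ _ _ fun s hs => ?_
    have := IsHomogeneous.prod s (fun i => (X i : MvPolynomial (Fin m) K)) (fun _ => 1)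
      fun i _ => isHomogeneous_X K i
    rwa [Finset.sum_const, smul_eq_mul, mul_one, (Finset.mem_powersetCard.1 hs).2] at this
  refine ⟨⟨_, hh.rename_isHomogeneous.pow p⟩, ?_⟩
  intro d hd i j
  have h : ∀ a, p ∣ d a := by
    intro a
    by_contra hn
    rw [mem_support_iff, ← map_frobenius_expand, coeff_map, coeff_expand_of_not_dvd _ hn,
      map_zero] at hd
    exact hd rfl
  exact dvd_add (h _) (h _)

/-- The algebra generated by the `c_r` and the `p`-th powers of the elementary symmetric
polynomials in `x`. -/
def smallAlgebra (K : Type*) [CommRing K] (p m n : ℕ) :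
    Subalgebra K (MvPolynomial (Fin m ⊕ Fin n) K) :=
  coeffAlgebra K (superSeries (xVar K m n) (yVar K m n)) ⊔
    coeffAlgebra K (elemSeries fun i => xVar K m n i ^ p)

lemma smallAlgebra_le {K : Type*} [CommRing K] (p : ℕ) [Fact p.Prime] [CharP K p] (m n : ℕ) :
    smallAlgebra K p m n ≤ Algebra.adjoin K
      ({f | IsSupersymmetric K m n f ∧ IsPBalanced K p m n f} ∪
        {f | ∃ r : ℕ, f = cpoly K m n r}) := by
  refine sup_le (Algebra.adjoin_mono ?_) (Algebra.adjoin_mono ?_)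
  · rintro _ ⟨r, rfl⟩
    exact Or.inr ⟨r, (cpoly_eq_coeff K m n r).symm⟩
  · rintro _ ⟨r, rfl⟩
    simp only [coeff_elemSeries_pow, coeff_elemSeries_xVar]
    exact Or.inl ⟨isSupersymmetric_sigmaX_pow p m n r, isPBalanced_sigmaX_pow p m n r⟩

lemma adjoin_le_superAlgebra {K : Type*} [CommRing K] (p : ℕ) {m n : ℕ} (hm : 1 ≤ m)
    (hn : 1 ≤ n) :
    Algebra.adjoin K ({f | IsSupersymmetric K m n f ∧ IsPBalanced K p m n f} ∪
        {f | ∃ r : ℕ, f = cpoly K m n r}) ≤ superAlgebra K m n := by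
  refine Algebra.adjoin_le ?_
  rintro f (hf | ⟨r, rfl⟩)
  exacts [hf.1, cpoly_mem_superAlgebra K hm hn r]

section Difference

variable {K ι : Type*} [Field K]

lemma sub_dvd_sub_rename_update [DecidableEq ι] (a b : ι) (h : MvPolynomial ι K) :
    X a - X b ∣ h - rename (Function.update id b a) h := by
  rw [← Ideal.mem_span_singleton, ← Ideal.Quotient.eq]
  set I := Ideal.span {(X a - X b : MvPolynomial ι K)}
  have : (Ideal.Quotient.mkₐ K I) = (Ideal.Quotient.mkₐ K I).comp
      (rename (Function.update id b a)) := by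
    ext i
    by_cases hi : i = b
    · subst hi
      simp only [AlgHom.comp_apply, rename_X, Function.update_self, Ideal.Quotient.mkₐ_eq_mk]
      refine Eq.symm (Ideal.Quotient.eq.2 (Ideal.mem_span_singleton_self _))
    · simp [Function.update_of_ne hi]
  exact DFunLike.congr_fun this h

lemma sub_dvd_iff [DecidableEq ι] {a b : ι} (hab : a ≠ b) (h : MvPolynomial ι K) :
    X a - X b ∣ h ↔ rename (Function.update id b a) h = 0 := by
  constructor
  · rintro ⟨g, rfl⟩
    rw [map_mul, map_sub, rename_X, rename_X, Function.update_self, Function.update_of_ne hab]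
    simp
  · intro h0
    simpa [h0] using sub_dvd_sub_rename_update a b h

lemma prime_X_sub_X {a b : ι} (hab : a ≠ b) : Prime (X a - X b : MvPolynomial ι K) := by
  classical
  refine ⟨fun h => hab (X_injective (sub_eq_zero.1 h)), fun h => ?_, fun f g hfg => ?_⟩
  · have := (sub_dvd_iff hab (1 : MvPolynomial ι K)).1 h.dvd
    simp at this
  · rw [sub_dvd_iff hab] at *
    rwa [sub_dvd_iff hab, ← mul_eq_zero, ← map_mul]

lemma diffProd_dvd [DecidableEq ι] {b c : ℕ} {x : Fin b → ι} {y : Fin c → ι}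
    (hx : Function.Injective x) (hy : Function.Injective y) (hxy : ∀ i j, x i ≠ y j)
    {F : MvPolynomial ι K} (h : ∀ i j, rename (Function.update id (y j) (x i)) F = 0) :
    diffProd (fun i => (X (x i) : MvPolynomial ι K)) (fun j => X (y j)) ∣ F := by
  rw [diffProd, ← Fintype.prod_prod_type' (fun j i => (X (x i) - X (y j) : MvPolynomial ι K))]
  refine Fintype.prod_dvd_of_isRelPrime ?_ fun z => (sub_dvd_iff (hxy _ _) F).2 (h z.2 z.1)
  rintro ⟨j, i⟩ ⟨j', i'⟩ hne
  rw [Function.onFun, (prime_X_sub_X (hxy i j)).irreducible.isRelPrime_iff_not_dvd,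
    sub_dvd_iff (hxy i j), map_sub, rename_X, rename_X, sub_eq_zero,
    Function.update_of_ne (hxy _ _)]
  intro he
  have he := X_injective he
  by_cases hj : y j' = y j
  · rw [hj, Function.update_self] at he
    exact hne (Prod.ext (hy hj).symm (hx he).symm)
  · rw [Function.update_of_ne hj] at he
    exact hxy _ _ he

lemma dvd_of_pderiv_eq_zero (p : ℕ) [CharP K p] {a : ι} {G : MvPolynomial ι K}
    (h : pderiv a G = 0) {d : ι →₀ ℕ} (hd : d ∈ G.support) : p ∣ d a := by
  classical
  rw [← CharP.cast_eq_zero_iff K p]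
  by_cases h0 : d a = 0
  · rw [h0, Nat.cast_zero]
  have hle : Finsupp.single a 1 ≤ d := by
    rw [Finsupp.single_le_iff]
    omega
  have h1 := congrArg (coeff (d - Finsupp.single a 1)) h
  rw [coeff_pderiv, tsub_add_cancel_of_le hle, coeff_zero] at h1
  have h2 := (mul_eq_zero.1 h1).resolve_left (mem_support_iff.1 hd)
  rw [Finsupp.tsub_apply, Finsupp.single_eq_same] at h2
  rw [← h2, ← Nat.cast_add_one, Nat.sub_add_cancel (Nat.pos_of_ne_zero h0)]

lemma pderiv_diffProd {b c : ℕ} {x : Fin b → ι} {y : Fin c → ι} {a : ι}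
    (hx : ∀ i, x i ≠ a) (hy : ∀ j, y j ≠ a) :
    pderiv a (diffProd (fun i => (X (x i) : MvPolynomial ι K)) (fun j => X (y j))) = 0 := by
  have hmul (f g : MvPolynomial ι K) (hf : pderiv a f = 0) (hg : pderiv a g = 0) :
      pderiv a (f * g) = 0 := by simp [hf, hg]
  refine Finset.prod_induction _ (fun f => pderiv a f = 0) hmul (by simp) fun j _ => ?_
  refine Finset.prod_induction _ (fun f => pderiv a f = 0) hmul (by simp) fun i _ => ?_
  rw [map_sub, pderiv_X_of_ne (hx i), pderiv_X_of_ne (hy j), sub_zero]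

end Difference

section Symmetry

variable {K : Type*} [CommRing K] {m n : ℕ} {ι : Type*}

lemma rename_elim_perm {f : MvPolynomial (Fin m ⊕ Fin n) K} (hf : IsSupersymmetric K m n f)
    (u : Fin m → ι) (v : Fin n → ι) (σ : Equiv.Perm (Fin m)) (τ : Equiv.Perm (Fin n)) :
    rename (Sum.elim (u ∘ σ) (v ∘ τ)) f = rename (Sum.elim u v) f := by
  conv_rhs => rw [← hf.1 σ, ← hf.2.1 τ, rename_rename, rename_rename]
  congr 2
  ext t
  rcases t with t | t <;> rfl

lemma pderiv_eval₂ (ρ : MvPolynomial (Fin m ⊕ Fin n) K →+* MvPolynomial ι K) (a : ι)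
    (hρ : ∀ r, pderiv a (ρ r) = 0) (P : Polynomial (MvPolynomial (Fin m ⊕ Fin n) K)) :
    pderiv a (P.eval₂ ρ (X a)) = P.derivative.eval₂ ρ (X a) := by
  induction P using Polynomial.induction_on' with
  | add p q hp hq => simp only [Polynomial.eval₂_add, map_add, hp, hq]
  | monomial d r =>
    rw [Polynomial.eval₂_monomial, Polynomial.derivative_monomial, Polynomial.eval₂_monomial,
      Derivation.leibniz, hρ, Derivation.leibniz_pow, pderiv_X_self]
    simp [mul_comm, mul_left_comm, mul_assoc]

lemma pderiv_rename_of_last {f : MvPolynomial (Fin m ⊕ Fin n) K} (hf : IsSupersymmetric K m n f)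
    {u : Fin m → ι} {v : Fin n → ι} {a : ι} (hu : ∀ i, u i = a ↔ (i : ℕ) = m - 1)
    (hv : ∀ j, v j = a ↔ (j : ℕ) = n - 1) : pderiv a (rename (Sum.elim u v) f) = 0 := by
  classical
  set ρ : MvPolynomial (Fin m ⊕ Fin n) K →ₐ[K] MvPolynomial ι K := aeval (Sum.elim
    (fun i => if u i = a then 0 else X (u i)) (fun j => if v j = a then 0 else X (v j))) with hρ
  have h₁ : ∀ r, pderiv a (ρ r) = 0 := by
    intro r
    induction r using MvPolynomial.induction_on with
    | C r => simp [ρ, algebraMap_eq]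
    | add f g hf hg => rw [map_add, map_add, hf, hg, add_zero]
    | mul_X f t ht =>
      rw [map_mul, Derivation.leibniz, ht, smul_zero, add_zero]
      convert smul_zero _
      simp only [ρ, aeval_X]
      rcases t with t | t
      · by_cases h : u t = a
        · simp [h]
        · simp [h, pderiv_X_of_ne h]
      · by_cases h : v t = a
        · simp [h]
        · simp [h, pderiv_X_of_ne h]
  have h₂ : (rename (Sum.elim u v)).toRingHom =
      (Polynomial.eval₂RingHom ρ.toRingHom (X a)).comp (psiSub K m n).toRingHom := by
    apply MvPolynomial.ringHom_ext
    · intro r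
      simp [psiSub, algebraMap_eq, ρ]
    · intro t
      rcases t with t | t
      · by_cases h : (t : ℕ) = m - 1
        · simp [psiSub, h, (hu t).2 h]
        · simp [psiSub, h, hu, ρ]
      · by_cases h : (t : ℕ) = n - 1
        · simp [psiSub, h, (hv t).2 h]
        · simp [psiSub, h, hv, ρ]
  have h₃ : rename (Sum.elim u v) f = (psiSub K m n f).eval₂ ρ.toRingHom (X a) :=
    DFunLike.congr_fun h₂ f
  rw [h₃, pderiv_eval₂ _ _ h₁, hf.2.2, Polynomial.eval₂_zero]

lemma pderiv_rename_sumElim {f : MvPolynomial (Fin m ⊕ Fin n) K} (hf : IsSupersymmetric K m n f)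
    {u : Fin m → ι} {v : Fin n → ι} {a : ι} {i₀ : Fin m} {j₀ : Fin n}
    (hu : ∀ i, u i = a ↔ i = i₀) (hv : ∀ j, v j = a ↔ j = j₀) :
    pderiv a (rename (Sum.elim u v) f) = 0 := by
  have hi := i₀.2
  have hj := j₀.2
  rw [← rename_elim_perm hf u v (Equiv.swap ⟨m - 1, by omega⟩ i₀)
    (Equiv.swap ⟨n - 1, by omega⟩ j₀)]
  refine pderiv_rename_of_last hf (fun i => ?_) fun j => ?_
  · rw [Function.comp_apply, hu, Equiv.swap_apply_eq_iff, Equiv.swap_apply_right, Fin.ext_iff]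
  · rw [Function.comp_apply, hv, Equiv.swap_apply_eq_iff, Equiv.swap_apply_right, Fin.ext_iff]

end Symmetry

section Pinch

variable {m n k b c : ℕ}

lemma exists_equiv_extending {s : Fin k → Fin m} (hs : Function.Injective s) (h : k + b = m) :
    ∃ e : Fin k ⊕ Fin b ≃ Fin m, ∀ t, e (Sum.inl t) = s t := by
  classical
  have hc : Fintype.card ↥(Set.range s)ᶜ = b := by
    rw [Fintype.card_compl_set, Fintype.card_fin, Set.card_range_of_injective hs,
      Fintype.card_fin]
    omega
  exact ⟨(Equiv.sumCongr (Equiv.ofInjective s hs) (Fintype.equivFinOfCardEq hc).symm).trans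
    (Equiv.Set.sumCompl (Set.range s)), fun t => rfl⟩

/-- The map on `x`-indices identifying `k` of the `x` variables with `y` variables. -/
def pinchX (c : ℕ) (e : Fin k ⊕ Fin b ≃ Fin m) (i : Fin m) : Fin k ⊕ (Fin b ⊕ Fin c) :=
  Sum.map id Sum.inl (e.symm i)

/-- The map on `y`-indices identifying `k` of the `y` variables with `x` variables. -/
def pinchY (b : ℕ) (e : Fin k ⊕ Fin c ≃ Fin n) (j : Fin n) : Fin k ⊕ (Fin b ⊕ Fin c) :=
  Sum.map id Sum.inr (e.symm j)

variable (e : Fin k ⊕ Fin b ≃ Fin m) (e' : Fin k ⊕ Fin c ≃ Fin n)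

lemma elemSeries_pinchX {R : Type*} [CommRing R] (h : Fin k ⊕ (Fin b ⊕ Fin c) → R) :
    elemSeries (fun i => h (pinchX c e i)) =
      elemSeries (fun t => h (Sum.inl t)) * elemSeries (fun i => h (Sum.inr (Sum.inl i))) := by
  rw [← elemSeries_comp_equiv e, ← elemSeries_sumElim]
  congr 1
  ext z
  rcases z with z | z <;> simp [pinchX]

lemma elemSeries_pinchY {R : Type*} [CommRing R] (h : Fin k ⊕ (Fin b ⊕ Fin c) → R) :
    elemSeries (fun j => h (pinchY b e' j)) =
      elemSeries (fun t => h (Sum.inl t)) * elemSeries (fun j => h (Sum.inr (Sum.inr j))) := by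
  rw [← elemSeries_comp_equiv e', ← elemSeries_sumElim]
  congr 1
  ext z
  rcases z with z | z <;> simp [pinchY]

/-- The polynomial vanishes whenever `k` pairs of `x` and `y` variables are identified. -/
def VanishesOn {K : Type*} [CommSemiring K] (k : ℕ) (f : MvPolynomial (Fin m ⊕ Fin n) K) : Prop :=
  ∀ (ι : Type) (u : Fin m → ι) (v : Fin n → ι) (s : Fin k → Fin m) (t : Fin k → Fin n),
    Function.Injective s → Function.Injective t → (∀ i, u (s i) = v (t i)) →
    rename (Sum.elim u v) f = 0

variable {K : Type*} [Field K]

lemma diffProd_dvd_pinch {g : MvPolynomial (Fin m ⊕ Fin n) K} (hg : VanishesOn (k + 1) g) :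
    diffProd (fun i => (X (Sum.inr (Sum.inl i)) : MvPolynomial (Fin k ⊕ (Fin b ⊕ Fin c)) K))
      (fun j => X (Sum.inr (Sum.inr j))) ∣ rename (Sum.elim (pinchX c e) (pinchY b e')) g := by
  classical
  refine diffProd_dvd (Sum.inr_injective.comp Sum.inl_injective)
    (Sum.inr_injective.comp Sum.inr_injective) (by simp) fun i j => ?_
  rw [rename_rename, Sum.comp_elim]
  refine hg _ _ _ (Fin.cons (e (Sum.inr i)) fun t => e (Sum.inl t))
    (Fin.cons (e' (Sum.inr j)) fun t => e' (Sum.inl t)) ?_ ?_ fun t => ?_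
  · rw [Fin.cons_injective_iff]
    exact ⟨by simp, e.injective.comp Sum.inl_injective⟩
  · rw [Fin.cons_injective_iff]
    exact ⟨by simp, e'.injective.comp Sum.inl_injective⟩
  · refine Fin.cases ?_ (fun t => ?_) t <;> simp [pinchX, pinchY, Function.update_apply]

lemma diffProd_X_ne_zero : diffProd
    (fun i => (X (Sum.inr (Sum.inl i)) : MvPolynomial (Fin k ⊕ (Fin b ⊕ Fin c)) K))
    (fun j => X (Sum.inr (Sum.inr j))) ≠ 0 := by
  refine Finset.prod_ne_zero_iff.2 fun j _ => Finset.prod_ne_zero_iff.2 fun i _ h => ?_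
  have := X_injective (sub_eq_zero.1 h)
  simp at this

lemma rename_quotient_eq {ι : Type*} {F D G : MvPolynomial ι K} (hF : F = D * G) (hD : D ≠ 0)
    {w : ι → ι} (hwF : rename w F = F) (hwD : rename w D = D) : rename w G = G := by
  apply mul_left_cancel₀ hD
  rw [← hF, ← hwF, hF, map_mul, hwD]

lemma pinch_mem (p : ℕ) [Fact p.Prime] [CharP K p] {g : MvPolynomial (Fin m ⊕ Fin n) K}
    (hg : IsSupersymmetric K m n g) (hv : VanishesOn (k + 1) g) :
    rename (Sum.elim (pinchX c e) (pinchY b e')) g ∈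
      (smallAlgebra K p m n).map (rename (Sum.elim (pinchX c e) (pinchY b e'))) := by
  obtain ⟨G, hG⟩ := diffProd_dvd_pinch e e' hv
  have hG₀ : ∀ σ : Equiv.Perm (Fin k), rename (Sum.map σ id) G = G := by
    intro σ
    refine rename_quotient_eq hG diffProd_X_ne_zero ?_ ?_
    · conv_rhs => rw [← rename_elim_perm hg _ _
        ((e.symm.trans (Equiv.sumCongr σ (Equiv.refl _))).trans e)
        ((e'.symm.trans (Equiv.sumCongr σ (Equiv.refl _))).trans e')]
      rw [rename_rename, Sum.comp_elim]
      congr 3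
      · ext i
        obtain ⟨z | z, rfl⟩ := e.surjective i <;> simp [pinchX]
      · ext i
        obtain ⟨z | z, rfl⟩ := e'.surjective i <;> simp [pinchY]
    · simp [diffProd, map_prod]
  have hG₁ : ∀ σ : Equiv.Perm (Fin b), rename (Sum.map id (Sum.map σ id)) G = G := by
    intro σ
    refine rename_quotient_eq hG diffProd_X_ne_zero ?_ ?_
    · conv_rhs => rw [← rename_elim_perm hg _ _
        ((e.symm.trans (Equiv.sumCongr (Equiv.refl _) σ)).trans e) (Equiv.refl _)]
      rw [rename_rename, Sum.comp_elim]
      congr 3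
      · ext i
        obtain ⟨z | z, rfl⟩ := e.surjective i <;> simp [pinchX]
      · ext i
        obtain ⟨z | z, rfl⟩ := e'.surjective i <;> simp [pinchY]
    · simp only [diffProd, map_prod, map_sub, rename_X, Sum.map_inr, Sum.map_inl, id]
      exact Finset.prod_congr rfl fun j _ => Equiv.prod_comp σ fun i =>
        (X (Sum.inr (Sum.inl i)) - X (Sum.inr (Sum.inr j)) :
          MvPolynomial (Fin k ⊕ (Fin b ⊕ Fin c)) K)
  have hG₂ : ∀ σ : Equiv.Perm (Fin c), rename (Sum.map id (Sum.map id σ)) G = G := by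
    intro σ
    refine rename_quotient_eq hG diffProd_X_ne_zero ?_ ?_
    · conv_rhs => rw [← rename_elim_perm hg _ _ (Equiv.refl _)
        ((e'.symm.trans (Equiv.sumCongr (Equiv.refl _) σ)).trans e')]
      rw [rename_rename, Sum.comp_elim]
      congr 3
      · ext i
        obtain ⟨z | z, rfl⟩ := e.surjective i <;> simp [pinchX]
      · ext i
        obtain ⟨z | z, rfl⟩ := e'.surjective i <;> simp [pinchY]
    · simp only [diffProd, map_prod, map_sub, rename_X, Sum.map_inr, Sum.map_inl, id]
      exact Equiv.prod_comp σ fun j => ∏ i,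
        (X (Sum.inr (Sum.inl i)) - X (Sum.inr (Sum.inr j)) :
          MvPolynomial (Fin k ⊕ (Fin b ⊕ Fin c)) K)
  have hdvd : ∀ d ∈ G.support, ∀ t, p ∣ d (Sum.inl t) := by
    intro d hd t
    refine dvd_of_pderiv_eq_zero p ?_ hd
    have h := pderiv_rename_sumElim hg (u := pinchX c e) (v := pinchY b e') (a := Sum.inl t)
      (i₀ := e (Sum.inl t)) (j₀ := e' (Sum.inl t))
      (fun i => by obtain ⟨z | z, rfl⟩ := e.surjective i <;> simp [pinchX])
      (fun i => by obtain ⟨z | z, rfl⟩ := e'.surjective i <;> simp [pinchY])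
    rw [hG, Derivation.leibniz, pderiv_diffProd (by simp) (by simp), smul_zero, add_zero,
      smul_eq_mul] at h
    exact (mul_eq_zero.1 h).resolve_left diffProd_X_ne_zero
  rw [hG]
  refine diffProd_mul_mem_of_union _ (fun i => X (Sum.inr (Sum.inl i)) ^ p) _
    (fun _ _ h => by simpa using X_injective h) ?_ ?_ ?_
    (mem_sup_sup_coeffAlgebra_of_symmetric (Fact.out : p.Prime).ne_zero hG₀ hG₁ hG₂ hdvd)
  · refine Algebra.adjoin_le ?_
    rintro _ ⟨r, rfl⟩
    simp only [coeff_elemSeries_pow]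
    exact Subalgebra.pow_mem _ (coeff_mem_coeffAlgebra _ _ _) _
  · refine le_trans (le_of_eq ?_) (Subalgebra.map_mono le_sup_left)
    rw [map_coeffAlgebra]
    congr 1
    rw [map_superSeries]
    apply eq_superSeries
    simp only [RingHom.coe_coe, rename_X, Sum.elim_inl, Sum.elim_inr]
    rw [elemSeries_pinchX e fun z => (X z : MvPolynomial _ K),
      elemSeries_pinchY e' fun z => (X z : MvPolynomial _ K), mul_left_comm, superSeries_mul]
  · refine le_trans (le_of_eq ?_) (Subalgebra.map_mono le_sup_right)
    rw [map_coeffAlgebra]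
    congr 1
    rw [map_elemSeries]
    simp only [RingHom.coe_coe, map_pow, rename_X, Sum.elim_inl]
    rw [elemSeries_pinchX e fun z => (X z ^ p : MvPolynomial _ K)]

lemma vanishesOn_of_pinch {e : Fin k ⊕ Fin b ≃ Fin m} {e' : Fin k ⊕ Fin c ≃ Fin n}
    (hb : k + b = m) (hc : k + c = n) {f : MvPolynomial (Fin m ⊕ Fin n) K}
    (hf : IsSupersymmetric K m n f)
    (h : rename (Sum.elim (pinchX c e) (pinchY b e')) f = 0) : VanishesOn k f := by
  intro ι u v s t hs ht hst
  obtain ⟨es, hes⟩ := exists_equiv_extending hs hb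
  obtain ⟨et, het⟩ := exists_equiv_extending ht hc
  rw [← rename_elim_perm hf u v (e.symm.trans es) (e'.symm.trans et)]
  have hw := congrArg (rename (R := K) (Sum.elim (fun z => u (s z))
    (Sum.elim (fun i => u (es (Sum.inr i))) fun j => v (et (Sum.inr j))))) h
  rw [rename_rename, Sum.comp_elim, map_zero] at hw
  rw [← hw]
  congr 3
  · ext i
    obtain ⟨z | z, rfl⟩ := e.surjective i <;> simp [pinchX, hes]
  · ext i
    obtain ⟨z | z, rfl⟩ := e'.surjective i <;> simp [pinchY, het, hst]

lemma smallAlgebra_le_superAlgebra (p : ℕ) [Fact p.Prime] [CharP K p] (hm : 1 ≤ m)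
    (hn : 1 ≤ n) : smallAlgebra K p m n ≤ superAlgebra K m n :=
  (smallAlgebra_le p m n).trans (adjoin_le_superAlgebra p hm hn)

lemma exists_sub_vanishesOn (p : ℕ) [Fact p.Prime] [CharP K p] (hm : 1 ≤ m) (hn : 1 ≤ n)
    {g : MvPolynomial (Fin m ⊕ Fin n) K} (hg : IsSupersymmetric K m n g)
    (hv : VanishesOn (k + 1) g) : ∃ a ∈ smallAlgebra K p m n, VanishesOn k (g - a) := by
  by_cases h : k ≤ m ∧ k ≤ n
  · obtain ⟨b, rfl⟩ := Nat.exists_eq_add_of_le h.1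
    obtain ⟨c, rfl⟩ := Nat.exists_eq_add_of_le h.2
    obtain ⟨a, ha, hag⟩ := pinch_mem finSumFinEquiv finSumFinEquiv p hg hv
    refine ⟨a, ha, vanishesOn_of_pinch rfl rfl (e := finSumFinEquiv) (e' := finSumFinEquiv)
      ((superAlgebra K _ _).sub_mem hg (smallAlgebra_le_superAlgebra p hm hn ha)) ?_⟩
    rw [map_sub, sub_eq_zero]
    exact hag.symm
  · refine ⟨0, Subalgebra.zero_mem _, fun ι u v s t hs ht => (h ⟨?_, ?_⟩).elim⟩
    · simpa using Fintype.card_le_of_injective s hs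
    · simpa using Fintype.card_le_of_injective t ht

lemma superAlgebra_le_smallAlgebra (p : ℕ) [Fact p.Prime] [CharP K p] (hm : 1 ≤ m)
    (hn : 1 ≤ n) : superAlgebra K m n ≤ smallAlgebra K p m n := by
  intro f hf
  have key : ∀ d k, k + d = m + 1 → ∃ a ∈ smallAlgebra K p m n, VanishesOn k (f - a) := by
    intro d
    induction d with
    | zero =>
      rintro k rfl
      refine ⟨0, Subalgebra.zero_mem _, fun ι u v s t hs ht => ?_⟩
      have := Fintype.card_le_of_injective s hs
      simp at this
    | succ d ih =>
      intro k hk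
      obtain ⟨a, ha, hv⟩ := ih (k + 1) (by omega)
      obtain ⟨a', ha', hv'⟩ := exists_sub_vanishesOn p hm hn ((superAlgebra K m n).sub_mem hf
        (smallAlgebra_le_superAlgebra p hm hn ha)) hv
      exact ⟨a + a', Subalgebra.add_mem _ ha ha', by rwa [← sub_sub]⟩
  obtain ⟨a, ha, hv⟩ := key (m + 1) 0 (by omega)
  have h := hv _ Sum.inl Sum.inr Fin.elim0 Fin.elim0 (fun i => i.elim0) (fun i => i.elim0)
    fun i => i.elim0
  rw [Sum.elim_inl_inr, rename_id_apply, sub_eq_zero] at h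
  rwa [h]

end Pinch

/-- **Theorem 1 (Conjecture 5.2 of La Scala–Zubkov).** Over an algebraically closed field of
characteristic `p > 2`, the algebra `A_s(m|n)` of supersymmetric polynomials is generated over
the subalgebra `A_s(p)` (generated by the `p`-balanced supersymmetric polynomials) by the
elements `c_r`, `r ≥ 0`. -/
theorem As_generated_over_Asp_by_cr (K : Type*) [Field K] [IsAlgClosed K]
    (p : ℕ) [CharP K p] (hp : 2 < p) (m n : ℕ) (hm : 1 ≤ m) (hn : 1 ≤ n) :
    {f : MvPolynomial (Fin m ⊕ Fin n) K | IsSupersymmetric K m n f} =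
      (Algebra.adjoin K
        ({f | IsSupersymmetric K m n f ∧ IsPBalanced K p m n f} ∪
          {f | ∃ r : ℕ, f = cpoly K m n r}) : Subalgebra K (MvPolynomial (Fin m ⊕ Fin n) K)) := by
  have : Fact p.Prime := ⟨CharP.char_is_prime_of_two_le K p (by omega)⟩
  exact congrArg (fun A : Subalgebra K (MvPolynomial (Fin m ⊕ Fin n) K) =>
    (A : Set (MvPolynomial (Fin m ⊕ Fin n) K)))
    (le_antisymm ((superAlgebra_le_smallAlgebra p hm hn).trans (smallAlgebra_le p m n))
      (adjoin_le_superAlgebra p hm hn))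

end
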